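/- Let K ∈ ℕ, let Δ ⊆ ℝ^K be the standard probability simplex, let λ > 0, μ > 0, let 2 ≤ s ≤ T be integers, and let c > 1 be a real constant. For t = 1, …, T let f_t : ℝ^K → ℝ be differentiable and λ-strongly concave, let q_1 ∈ Δ, let g_t = ∇f_t(q_t) satisfy ‖g_t‖₂ ≤ μ, and let q_{t+1} be the Euclidean projection of q_t + η_t g_t onto Δ, where η_t = 1/(c λ t) for t ≤ s and η_t = 1/(λ t) for t > s. Then for every q* ∈ Δ, Σ_{t=1}^T (f_t(q*) − f_t(q_t)) ≤ s λ (c − 1) + (μ²/(2λ)) (log s)(1/c − 1) + (μ²/(2λ)) (log T + 1). (Mixed-learning-rate regret bound in the proof of Theorem 3, before optimizing the constant c, using diameter bound ‖p − p'‖₂² ≤ 2 on the simplex.) -/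

import Mathlib

open RealInnerProductSpace

/-- The standard probability simplex in `ℝ^K` (with the Euclidean norm). -/
def probSimplex (K : ℕ) : Set (EuclideanSpace ℝ (Fin K)) :=
  {p | (∑ k, p k) = 1 ∧ ∀ k, 0 ≤ p k}

theorem convex_probSimplex (K : ℕ) : Convex ℝ (probSimplex K) := by
  intro x hx y hy a b ha hb hab
  refine ⟨?_, fun k => ?_⟩
  · simp [Finset.sum_add_distrib, ← Finset.mul_sum, hx.1, hy.1, hab]
  · have := mul_nonneg ha (hx.2 k)
    have := mul_nonneg hb (hy.2 k)
    simp only [PiLp.add_apply, PiLp.smul_apply, smul_eq_mul]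
    linarith

theorem norm_sub_sq_le_two_of_mem_probSimplex {K : ℕ} {p p' : EuclideanSpace ℝ (Fin K)}
    (hp : p ∈ probSimplex K) (hp' : p' ∈ probSimplex K) : ‖p - p'‖ ^ 2 ≤ 2 := by
  have le_one : ∀ r ∈ probSimplex K, ∀ k, r k ≤ 1 := fun r hr k =>
    hr.1 ▸ Finset.single_le_sum (f := fun k => r k) (fun i _ => hr.2 i) (Finset.mem_univ k)
  rw [EuclideanSpace.norm_sq_eq]
  calc ∑ k, ‖(p - p') k‖ ^ 2 ≤ ∑ k, (p k + p' k) := by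
        refine Finset.sum_le_sum fun k _ => ?_
        rw [Real.norm_eq_abs, sq_abs, PiLp.sub_apply]
        nlinarith [hp.2 k, hp'.2 k, le_one p hp k, le_one p' hp' k,
          mul_nonneg (hp.2 k) (hp'.2 k)]
    _ = 2 := by rw [Finset.sum_add_distrib, hp.1, hp'.1]; norm_num

/-- A nearest point of a convex set to `v` is at least as close as `v` to every point of the
set. -/
theorem norm_sub_sq_le_of_nearest {E : Type*} [NormedAddCommGroup E] [InnerProductSpace ℝ E]
    {C : Set E} (hC : Convex ℝ C) {v w p : E} (hw : w ∈ C)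
    (hmin : ∀ x ∈ C, ‖w - v‖ ≤ ‖x - v‖) (hp : p ∈ C) : ‖w - p‖ ^ 2 ≤ ‖v - p‖ ^ 2 := by
  have hinf : ‖v - w‖ = ⨅ x : C, ‖v - x‖ := by
    have : Nonempty C := ⟨⟨w, hw⟩⟩
    refine le_antisymm (le_ciInf fun x => ?_) ?_
    · rw [norm_sub_rev v w, norm_sub_rev v x]
      exact hmin x x.2
    · exact ciInf_le (f := fun x : C => ‖v - x‖) ⟨0, by rintro _ ⟨x, rfl⟩; exact norm_nonneg _⟩
        ⟨w, hw⟩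
  have hobtuse := (norm_eq_iInf_iff_real_inner_le_zero hC hw).1 hinf p hp
  have hexp := norm_sub_sq_real (v - w) (p - w)
  rw [sub_sub_sub_cancel_right, norm_sub_rev p w] at hexp
  nlinarith [sq_nonneg ‖v - w‖]

/-- One step of projected gradient ascent: the linearized regret is controlled by the decrease
of the squared distance to the comparator. -/
theorem inner_le_of_projected_step {E : Type*} [NormedAddCommGroup E] [InnerProductSpace ℝ E]
    {C : Set E} (hC : Convex ℝ C) {x g w p : E} {a mu : ℝ} (ha : 0 < a) (hg : ‖g‖ ≤ mu)
    (hw : w ∈ C) (hmin : ∀ y ∈ C, ‖w - (x + (1 / a) • g)‖ ≤ ‖y - (x + (1 / a) • g)‖)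
    (hp : p ∈ C) :
    ⟪g, p - x⟫ ≤ a / 2 * (‖x - p‖ ^ 2 - ‖w - p‖ ^ 2) + mu ^ 2 / (2 * a) := by
  have hle := norm_sub_sq_le_of_nearest hC hw hmin hp
  have hexp := norm_add_sq_real (x - p) ((1 / a) • g)
  rw [norm_smul, inner_smul_right, mul_pow, Real.norm_eq_abs, sq_abs, ← neg_sub p x,
    inner_neg_left, real_inner_comm, norm_neg] at hexp
  rw [show x + (1 / a) • g - p = -(p - x) + (1 / a) • g by abel, hexp] at hle
  have hgsq : ‖g‖ ^ 2 ≤ mu ^ 2 := pow_le_pow_left₀ (norm_nonneg g) hg 2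
  have hgdiv : ‖g‖ ^ 2 / (2 * a) ≤ mu ^ 2 / (2 * a) := by gcongr
  have hmul := mul_le_mul_of_nonneg_left hle (half_pos ha).le
  have hsimp : a / 2 * (‖p - x‖ ^ 2 + 2 * (1 / a * -⟪g, p - x⟫) + (1 / a) ^ 2 * ‖g‖ ^ 2)
      = a / 2 * ‖p - x‖ ^ 2 - ⟪g, p - x⟫ + ‖g‖ ^ 2 / (2 * a) := by
    field_simp
    ring
  rw [hsimp] at hmul
  rw [norm_sub_rev x p]
  linarith

theorem log_le_harmonic {n : ℕ} (hn : 0 < n) : Real.log n ≤ harmonic n :=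
  (Real.log_le_log (by exact_mod_cast hn) (by push_cast; linarith)).trans
    (log_add_one_le_harmonic n)

/-- Summation of the one-step bounds for the step sizes `1 / (c λ t)` up to time `s` and
`1 / (λ t)` afterwards; `d t` is the squared distance to the comparator. -/
theorem sum_le_of_mixed_rate_step {T s : ℕ} {lam mu c : ℝ} (hlam : 0 < lam) (hc : 1 < c)
    (hs : 0 < s) (hsT : s ≤ T) {r d : ℕ → ℝ} (hd0 : ∀ t, 0 ≤ d t)
    (hd2 : ∀ t, 1 ≤ t → t ≤ T → d t ≤ 2)
    (hstep : ∀ t, 1 ≤ t → t ≤ T →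
      r t ≤ (if t ≤ s then c * lam * t else lam * t) / 2 * (d t - d (t + 1))
        + mu ^ 2 / (2 * (if t ≤ s then c * lam * t else lam * t)) - lam / 2 * d t) :
    ∑ t ∈ Finset.Icc 1 T, r t
      ≤ s * lam * (c - 1) + mu ^ 2 / (2 * lam) * Real.log s * (1 / c - 1)
        + mu ^ 2 / (2 * lam) * (Real.log T + 1) := by
  have hc0 : 0 < c := one_pos.trans hc
  have early : ∀ n ≤ s, ∑ t ∈ Finset.Icc 1 n, r t
      ≤ n * lam * (c - 1) - c * lam * n / 2 * d (n + 1)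
        + mu ^ 2 / (2 * lam) * (1 / c) * harmonic n := by
    intro n
    induction n with
    | zero => simp
    | succ n ih =>
      intro hn
      have hih := ih (by omega)
      have hst := hstep (n + 1) (by omega) (by omega)
      rw [if_pos hn] at hst
      have hdn := mul_le_mul_of_nonneg_left (hd2 (n + 1) (by omega) (by omega))
        (mul_pos hlam (sub_pos.2 hc)).le
      rw [Finset.sum_Icc_succ_top (by omega), harmonic_succ]
      have hfrac : mu ^ 2 / (2 * (c * lam * ((n + 1 : ℕ) : ℝ)))
          = mu ^ 2 / (2 * lam) * (1 / c) * ((n : ℝ) + 1)⁻¹ := by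
        push_cast
        field_simp
      rw [hfrac] at hst
      push_cast at hst hih ⊢
      linarith
  have late : ∀ n, s ≤ n → n ≤ T → ∑ t ∈ Finset.Icc 1 n, r t
      ≤ s * lam * (c - 1) - lam * n / 2 * d (n + 1)
        + mu ^ 2 / (2 * lam) * (harmonic n + (1 / c - 1) * harmonic s) := by
    intro n hsn
    induction n, hsn using Nat.le_induction with
    | base =>
      intro _
      have hs' := early s le_rfl
      have hdrop : 0 ≤ (c - 1) * (lam * s / 2 * d (s + 1)) :=
        mul_nonneg (sub_pos.2 hc).le (mul_nonneg (by positivity) (hd0 _))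
      linarith
    | succ n hsn ih =>
      intro hn
      have hih := ih (by omega)
      have hst := hstep (n + 1) (by omega) hn
      rw [if_neg (by omega)] at hst
      rw [Finset.sum_Icc_succ_top (by omega), harmonic_succ]
      have hfrac : mu ^ 2 / (2 * (lam * ((n + 1 : ℕ) : ℝ)))
          = mu ^ 2 / (2 * lam) * ((n : ℝ) + 1)⁻¹ := by
        push_cast
        field_simp
      rw [hfrac] at hst
      push_cast at hst hih ⊢
      linarith
  have hfinal := late T hsT le_rfl
  have hdrop : 0 ≤ lam * T / 2 * d (T + 1) := mul_nonneg (by positivity) (hd0 _)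
  have hcoef : 1 / c - 1 ≤ 0 := sub_nonpos.2 ((div_le_one hc0).2 hc.le)
  have hharm : (harmonic T : ℝ) + (1 / c - 1) * harmonic s
      ≤ (1 / c - 1) * Real.log s + (Real.log T + 1) := by
    linarith [harmonic_le_one_add_log T, mul_le_mul_of_nonpos_left (log_le_harmonic hs) hcoef]
  have hmul := mul_le_mul_of_nonneg_left hharm
    (show 0 ≤ mu ^ 2 / (2 * lam) by positivity)
  linarith

/-- Mixed-learning-rate regret bound in the proof of Theorem 3, before optimizing
the constant `c`:  `η_t = 1/(c λ t)` for `t ≤ s` and `η_t = 1/(λ t)` for `t > s`. -/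
theorem projected_gradient_ascent_mixed_rate_regret
    (K T s : ℕ) (lam mu c : ℝ) (hlam : 0 < lam) (hmu : 0 < mu) (hc : 1 < c)
    (hs2 : 2 ≤ s) (hsT : s ≤ T)
    (f : ℕ → EuclideanSpace ℝ (Fin K) → ℝ)
    (G : ℕ → EuclideanSpace ℝ (Fin K) → EuclideanSpace ℝ (Fin K))
    (q : ℕ → EuclideanSpace ℝ (Fin K))
    (hgrad : ∀ t x, HasGradientAt (f t) (G t x) x)
    (hconc : ∀ t x y, f t y ≤ f t x + ⟪G t x, y - x⟫ - lam / 2 * ‖y - x‖ ^ 2)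
    (hq1 : q 1 ∈ probSimplex K)
    (hgbound : ∀ t, 1 ≤ t → t ≤ T → ‖G t (q t)‖ ≤ mu)
    (hproj : ∀ t, 1 ≤ t → t ≤ T →
      q (t + 1) ∈ probSimplex K ∧
      ∀ p ∈ probSimplex K,
        ‖q (t + 1) - (q t + (if t ≤ s then 1 / (c * lam * t) else 1 / (lam * t)) • G t (q t))‖
          ≤ ‖p - (q t + (if t ≤ s then 1 / (c * lam * t) else 1 / (lam * t)) • G t (q t))‖) :
    ∀ qstar ∈ probSimplex K,
      ∑ t ∈ Finset.Icc 1 T, (f t qstar - f t (q t))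
        ≤ s * lam * (c - 1) + mu ^ 2 / (2 * lam) * Real.log s * (1 / c - 1)
          + mu ^ 2 / (2 * lam) * (Real.log T + 1) := by
  intro qstar hqstar
  have hmem : ∀ t, 1 ≤ t → t ≤ T → q t ∈ probSimplex K := by
    intro t ht htT
    obtain rfl | ht' := ht.eq_or_lt
    · exact hq1
    · obtain ⟨n, rfl⟩ := Nat.exists_eq_add_of_le' ht
      exact (hproj n (by omega) (by omega)).1
  refine sum_le_of_mixed_rate_step (d := fun t => ‖q t - qstar‖ ^ 2) hlam hc (by omega) hsT
    (fun t => sq_nonneg _)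
    (fun t ht htT => norm_sub_sq_le_two_of_mem_probSimplex (hmem t ht htT) hqstar)
    fun t ht htT => ?_
  have htpos : (0 : ℝ) < t := by exact_mod_cast ht
  have hc0 : 0 < c := one_pos.trans hc
  obtain ⟨hnext, hmin⟩ := hproj t ht htT
  have hrate : (if t ≤ s then 1 / (c * lam * t) else 1 / (lam * t))
      = 1 / (if t ≤ s then c * lam * t else lam * t) := by
    split_ifs <;> rfl
  rw [hrate] at hmin
  have hinner := inner_le_of_projected_step (convex_probSimplex K)
    (by split_ifs <;> positivity) (hgbound t ht htT) hnext hmin hqstar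
  have hcon := hconc t (q t) qstar
  rw [norm_sub_rev qstar (q t)] at hcon
  linarith
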